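/- Let n, m ≥ 2, let A ∈ ℝ^{n×m} have nonnegative entries with no zero row and no zero column, and let p ∈ ℝ^n, q ∈ ℝ^m have strictly positive entries with ∑_{i=1}^n p_i = ∑_{j=1}^m q_j. Suppose ε_p(A) > 0 and, setting w = V(A)/min_i p_i, suppose w < 1, ε_p(A) < (1+w)/(1−w), and 2w(1 + w·r(w, ε_p(A))) ≤ ε_p(A). Then the sequence (X^{(2t)})_{t≥0} of iterates of the alternating balancing procedure converges to a matrix X' ∈ ℝ^{n×m} which satisfies ∑_{j=1}^m x'_{ij} = p_i for all i and ∑_{i=1}^n x'_{ij} = q_j for all j; moreover X' has nonnegative entries and x'_{ij} = 0 whenever a_{ij} = 0. -/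

import Mathlib

open Finset

/-- Lyapunov function `V(X) = ∑ᵢ |∑ⱼ xᵢⱼ − pᵢ| + ∑ⱼ |∑ᵢ xᵢⱼ − qⱼ|`. -/
noncomputable def lyap {n m : ℕ} (p : Fin n → ℝ) (q : Fin m → ℝ)
    (X : Matrix (Fin n) (Fin m) ℝ) : ℝ :=
  ∑ i, |(∑ j, X i j) - p i| + ∑ j, |(∑ i, X i j) - q j|

/-- Row-balancing step `X'ᵢⱼ = pᵢ xᵢⱼ / ∑ₗ xᵢₗ`. -/
noncomputable def rowBal {n m : ℕ} (p : Fin n → ℝ) (X : Matrix (Fin n) (Fin m) ℝ) :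
    Matrix (Fin n) (Fin m) ℝ :=
  fun i j => p i * X i j / ∑ l, X i l

/-- Column-balancing step `X''ᵢⱼ = qⱼ xᵢⱼ / ∑ₖ xₖⱼ`. -/
noncomputable def colBal {n m : ℕ} (q : Fin m → ℝ) (X : Matrix (Fin n) (Fin m) ℝ) :
    Matrix (Fin n) (Fin m) ℝ :=
  fun i j => q j * X i j / ∑ k, X k j

/-- Alternating balancing procedure: `X⁽⁰⁾ = A`, odd steps row-balance, even steps
column-balance. -/
noncomputable def iterBal {n m : ℕ} (p : Fin n → ℝ) (q : Fin m → ℝ)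
    (A : Matrix (Fin n) (Fin m) ℝ) : ℕ → Matrix (Fin n) (Fin m) ℝ
  | 0 => A
  | s + 1 => if s % 2 = 0 then rowBal p (iterBal p q A s) else colBal q (iterBal p q A s)

/-- `ε_p(X)`: minimum over nonempty proper subsets `Ĩ ⊊ {1,…,n}`, `J̃ ⊊ {1,…,m}` of
`min_{j∈J̃} ∑_{i∉Ĩ} xᵢⱼ/(∑ₖ xₖⱼ) + min_{j∉J̃} ∑_{i∈Ĩ} xᵢⱼ/(∑ₖ xₖⱼ)`. -/
noncomputable def epsP {n m : ℕ} (X : Matrix (Fin n) (Fin m) ℝ) : ℝ :=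
  sInf { v : ℝ | ∃ (I : Finset (Fin n)) (J : Finset (Fin m)),
    I.Nonempty ∧ I ≠ Finset.univ ∧ J.Nonempty ∧ J ≠ Finset.univ ∧
    v = sInf ((fun j => ∑ i ∈ Iᶜ, X i j / ∑ k, X k j) '' (J : Set (Fin m))) +
        sInf ((fun j => ∑ i ∈ I, X i j / ∑ k, X k j) '' ((Jᶜ : Finset (Fin m)) : Set (Fin m))) }

/-- `r(w, ε) = (4 − (1+ε)(1−w)²) / ((1 + εw − (1+ε)w²)(1−w))`. -/
noncomputable def rF (w ε : ℝ) : ℝ :=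
  (4 - (1 + ε) * (1 - w) ^ 2) / ((1 + ε * w - (1 + ε) * w ^ 2) * (1 - w))

/-- Frobenius norm. -/
noncomputable def frob {n m : ℕ} (X : Matrix (Fin n) (Fin m) ℝ) : ℝ :=
  Real.sqrt (∑ i, ∑ j, (X i j) ^ 2)

/-- Entrywise 1-norm `‖X‖₁ = ∑ᵢⱼ |xᵢⱼ|`. -/
noncomputable def norm1 {n m : ℕ} (X : Matrix (Fin n) (Fin m) ℝ) : ℝ :=
  ∑ i, ∑ j, |X i j|

def GoodM {n m : ℕ} (X : Matrix (Fin n) (Fin m) ℝ) : Prop :=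
  (∀ i j, 0 ≤ X i j) ∧ (∀ i, ∃ j, 0 < X i j) ∧ (∀ j, ∃ i, 0 < X i j)

def DobM {n m : ℕ} (X : Matrix (Fin n) (Fin m) ℝ) (e : ℝ) : Prop :=
  ∀ (I : Finset (Fin n)) (j j' : Fin m),
    e ≤ ∑ i ∈ Iᶜ, X i j / ∑ k, X k j + ∑ i ∈ I, X i j' / ∑ k, X k j'

lemma GoodM.row {n m : ℕ} {X : Matrix (Fin n) (Fin m) ℝ} (h : GoodM X) (i : Fin n) :
    0 < ∑ j, X i j := by
  obtain ⟨j, hj⟩ := h.2.1 i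
  exact Finset.sum_pos' (fun j _ => h.1 i j) ⟨j, Finset.mem_univ _, hj⟩

lemma GoodM.col {n m : ℕ} {X : Matrix (Fin n) (Fin m) ℝ} (h : GoodM X) (j : Fin m) :
    0 < ∑ i, X i j := by
  obtain ⟨i, hi⟩ := h.2.2 j
  exact Finset.sum_pos' (fun i _ => h.1 i j) ⟨i, Finset.mem_univ _, hi⟩

lemma GoodM.rowBal {n m : ℕ} {X : Matrix (Fin n) (Fin m) ℝ} (h : GoodM X)
    {p : Fin n → ℝ} (hp : ∀ i, 0 < p i) : GoodM (rowBal p X) := by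
  refine ⟨fun i j => ?_, fun i => ?_, fun j => ?_⟩
  · exact div_nonneg (mul_nonneg (hp i).le (h.1 i j)) (h.row i).le
  · obtain ⟨j, hj⟩ := h.2.1 i
    exact ⟨j, div_pos (mul_pos (hp i) hj) (h.row i)⟩
  · obtain ⟨i, hi⟩ := h.2.2 j
    exact ⟨i, div_pos (mul_pos (hp i) hi) (h.row i)⟩

lemma GoodM.colBal {n m : ℕ} {X : Matrix (Fin n) (Fin m) ℝ} (h : GoodM X)
    {q : Fin m → ℝ} (hq : ∀ i, 0 < q i) : GoodM (colBal q X) := by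
  refine ⟨fun i j => ?_, fun i => ?_, fun j => ?_⟩
  · exact div_nonneg (mul_nonneg (hq j).le (h.1 i j)) (h.col j).le
  · obtain ⟨j, hj⟩ := h.2.1 i
    exact ⟨j, div_pos (mul_pos (hq j) hj) (h.col j)⟩
  · obtain ⟨i, hi⟩ := h.2.2 j
    exact ⟨i, div_pos (mul_pos (hq j) hi) (h.col j)⟩

lemma rowBal_row {n m : ℕ} {X : Matrix (Fin n) (Fin m) ℝ} (h : GoodM X)
    (p : Fin n → ℝ) (i : Fin n) : ∑ j, rowBal p X i j = p i := by
  have := (h.row i).ne'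
  simp only [rowBal]
  rw [← Finset.sum_div, ← Finset.mul_sum]
  field_simp

lemma colBal_col {n m : ℕ} {X : Matrix (Fin n) (Fin m) ℝ} (h : GoodM X)
    (q : Fin m → ℝ) (j : Fin m) : ∑ i, colBal q X i j = q j := by
  have := (h.col j).ne'
  simp only [colBal]
  rw [← Finset.sum_div, ← Finset.mul_sum]
  field_simp

lemma colBal_dob {n m : ℕ} {X : Matrix (Fin n) (Fin m) ℝ} (h : GoodM X)
    {q : Fin m → ℝ} (hq : ∀ i, 0 < q i) {e : ℝ} (hd : DobM X e) : DobM (colBal q X) e := by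
  have key : ∀ i j, colBal q X i j / ∑ k, colBal q X k j = X i j / ∑ k, X k j := by
    intro i j
    rw [colBal_col h]
    have := (h.col j).ne'
    have := (hq j).ne'
    simp only [colBal]
    field_simp
  intro I j j'
  simp only [key]
  exact hd I j j'

lemma lyap_nonneg' {n m : ℕ} (p : Fin n → ℝ) (q : Fin m → ℝ)
    (X : Matrix (Fin n) (Fin m) ℝ) : 0 ≤ lyap p q X := by
  unfold lyap; positivity

lemma rowerr_le {n m : ℕ} (p : Fin n → ℝ) (q : Fin m → ℝ)
    (X : Matrix (Fin n) (Fin m) ℝ) : ∑ i, |(∑ j, X i j) - p i| ≤ lyap p q X := by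
  unfold lyap
  have : 0 ≤ ∑ j, |(∑ i, X i j) - q j| := by positivity
  linarith

lemma colerr_le {n m : ℕ} (p : Fin n → ℝ) (q : Fin m → ℝ)
    (X : Matrix (Fin n) (Fin m) ℝ) : ∑ j, |(∑ i, X i j) - q j| ≤ lyap p q X := by
  unfold lyap
  have : 0 ≤ ∑ i, |(∑ j, X i j) - p i| := by positivity
  linarith

lemma rowerr1 {n m : ℕ} (p : Fin n → ℝ) (q : Fin m → ℝ)
    (X : Matrix (Fin n) (Fin m) ℝ) (i : Fin n) : |(∑ j, X i j) - p i| ≤ lyap p q X :=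
  (Finset.single_le_sum (f := fun i => |(∑ j, X i j) - p i|) (fun _ _ => abs_nonneg _)
    (Finset.mem_univ i)).trans (rowerr_le p q X)

lemma colerr1 {n m : ℕ} (p : Fin n → ℝ) (q : Fin m → ℝ)
    (X : Matrix (Fin n) (Fin m) ℝ) (j : Fin m) : |(∑ i, X i j) - q j| ≤ lyap p q X :=
  (Finset.single_le_sum (f := fun j => |(∑ i, X i j) - q j|) (fun _ _ => abs_nonneg _)
    (Finset.mem_univ j)).trans (colerr_le p q X)

lemma ratio_le {n m : ℕ} {X : Matrix (Fin n) (Fin m) ℝ} (h : GoodM X)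
    {p : Fin n → ℝ} (hp : ∀ i, 0 < p i) (q : Fin m → ℝ) {μ w : ℝ} (hμ : 0 < μ)
    (hμp : ∀ i, μ ≤ p i) (hw : lyap p q X = w * μ) (i k : Fin n) :
    (1 - w) * (p k / ∑ j, X k j) ≤ p i / ∑ j, X i j := by
  have hV := lyap_nonneg' p q X
  have hw0 : 0 ≤ w := by
    by_contra hc
    push Not at hc
    nlinarith
  rcases eq_or_ne i k with rfl | hik
  · have : 0 ≤ p i / ∑ j, X i j := (div_pos (hp i) (h.row i)).le
    nlinarith
  have hsum : |(∑ j, X i j) - p i| + |(∑ j, X k j) - p k| ≤ w * μ := by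
    rw [← hw]
    refine le_trans ?_ (rowerr_le p q X)
    rw [← Finset.sum_pair (f := fun i => |(∑ j, X i j) - p i|) hik]
    exact Finset.sum_le_sum_of_subset_of_nonneg (Finset.subset_univ _)
      (fun _ _ _ => abs_nonneg _)
  have hri := h.row i
  have hrk := h.row k
  generalize (∑ j, X i j) = ri at *
  generalize (∑ j, X k j) = rk at *
  rw [← mul_div_assoc, div_le_div_iff₀ hrk hri]
  have ha := le_abs_self (ri - p i)
  have hb := neg_abs_le (rk - p k)
  have ha0 := abs_nonneg (ri - p i)
  have hb0 := abs_nonneg (rk - p k)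
  generalize |ri - p i| = a at *
  generalize |rk - p k| = b at *
  have hi := hp i
  have hk := hp k
  have hi' := hμp i
  have hk' := hμp k
  generalize p i = pi at *
  generalize p k = pk at *
  have h1 : pi * (pk - b) ≤ pi * rk := mul_le_mul_of_nonneg_left (by linarith) hi.le
  have h2 : pk * ri ≤ pk * (pi + a) := mul_le_mul_of_nonneg_left (by linarith) hk.le
  have h3 : pi * b + pk * a ≤ w * pi * pk := by
    have hab : a + b ≤ w * μ := hsum
    rcases le_total pi pk with hc | hc
    · have : pi * b ≤ pk * b := mul_le_mul_of_nonneg_right hc hb0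
      have : pk * (a + b) ≤ pk * (w * μ) := mul_le_mul_of_nonneg_left hab hk.le
      have : pk * (w * μ) ≤ pk * (w * pi) := by gcongr
      nlinarith
    · have : pk * a ≤ pi * a := mul_le_mul_of_nonneg_right hc ha0
      have : pi * (a + b) ≤ pi * (w * μ) := mul_le_mul_of_nonneg_left hab hi.le
      have : pi * (w * μ) ≤ pi * (w * pk) := by gcongr
      nlinarith
  have h4 : (1 - w) * (pk * ri) ≤ pi * rk := by
    rcases le_total w 1 with hc | hc
    · have : (1 - w) * (pk * ri) ≤ (1 - w) * (pk * (pi + a)) :=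
        mul_le_mul_of_nonneg_left h2 (by linarith)
      have : 0 ≤ w * (pk * a) := by positivity
      nlinarith
    · have : 0 ≤ (w - 1) * (pk * ri) := mul_nonneg (by linarith) (by positivity)
      have : 0 ≤ pi * rk := by positivity
      linarith
  linarith

lemma rowBal_dob {n m : ℕ} {X : Matrix (Fin n) (Fin m) ℝ} (h : GoodM X)
    {p : Fin n → ℝ} (hp : ∀ i, 0 < p i) (q : Fin m → ℝ) {μ w : ℝ} (hμ : 0 < μ)
    (hμp : ∀ i, μ ≤ p i) (hw : lyap p q X = w * μ) (hw1 : w < 1) {e : ℝ} (hd : DobM X e) :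
    DobM (rowBal p X) ((1 - w) * e) := by
  have key : ∀ i j, (1 - w) * (X i j / ∑ k, X k j) ≤
      rowBal p X i j / ∑ k, rowBal p X k j := by
    intro i j
    rw [← mul_div_assoc, div_le_div_iff₀ (h.col j) ((h.rowBal hp).col j),
      Finset.mul_sum, Finset.mul_sum]
    apply Finset.sum_le_sum
    intro k _
    have h1 := ratio_le h hp q hμ hμp hw i k
    have h2 := mul_le_mul_of_nonneg_right h1 (mul_nonneg (h.1 i j) (h.1 k j))
    have e1 : ∀ i, rowBal p X i j = p i / (∑ l, X i l) * X i j := by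
      intro i; simp only [rowBal]; ring
    rw [e1, e1]
    linarith
  intro I j j'
  have := mul_le_mul_of_nonneg_left (hd I j j') (by linarith : (0:ℝ) ≤ 1 - w)
  refine this.trans ?_
  rw [mul_add, Finset.mul_sum, Finset.mul_sum]
  exact add_le_add (Finset.sum_le_sum fun i _ => key i j) (Finset.sum_le_sum fun i _ => key i j')

lemma rowBal_sub {n m : ℕ} {X : Matrix (Fin n) (Fin m) ℝ} (h : GoodM X)
    (p : Fin n → ℝ) (i : Fin n) (j : Fin m) :
    |rowBal p X i j - X i j| = X i j / (∑ l, X i l) * |(∑ l, X i l) - p i| := by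
  have h0 := h.row i
  have : rowBal p X i j - X i j = X i j / (∑ l, X i l) * (p i - ∑ l, X i l) := by
    simp only [rowBal]
    field_simp
  rw [this, abs_mul, abs_of_nonneg (div_nonneg (h.1 i j) h0.le), abs_sub_comm]

lemma colBal_sub {n m : ℕ} {X : Matrix (Fin n) (Fin m) ℝ} (h : GoodM X)
    (q : Fin m → ℝ) (i : Fin n) (j : Fin m) :
    colBal q X i j - X i j = X i j / (∑ k, X k j) * (q j - ∑ k, X k j) := by
  have h0 := h.col j
  simp only [colBal]
  field_simp

lemma rowBal_err {n m : ℕ} {X : Matrix (Fin n) (Fin m) ℝ} (h : GoodM X)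
    (p : Fin n → ℝ) (q : Fin m → ℝ) :
    ∑ j, |(∑ i, rowBal p X i j) - q j| ≤ lyap p q X := by
  have h1 : ∀ j, |(∑ i, rowBal p X i j) - q j| ≤
      ∑ i, |rowBal p X i j - X i j| + |(∑ i, X i j) - q j| := by
    intro j
    have : (∑ i, rowBal p X i j) - q j =
      ∑ i, (rowBal p X i j - X i j) + ((∑ i, X i j) - q j) := by
      rw [Finset.sum_sub_distrib]; ring
    rw [this]
    exact (abs_add_le _ _).trans (add_le_add_left (Finset.abs_sum_le_sum_abs _ _) _)
  refine (Finset.sum_le_sum fun j _ => h1 j).trans ?_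
  rw [Finset.sum_add_distrib, Finset.sum_comm]
  unfold lyap
  apply add_le_add_left
  apply Finset.sum_le_sum
  intro i _
  simp only [rowBal_sub h]
  rw [← Finset.sum_mul, ← Finset.sum_div, div_self (h.row i).ne', one_mul]

lemma dobrushin {n m : ℕ} {X : Matrix (Fin n) (Fin m) ℝ} (h : GoodM X) (hm : 0 < m)
    {e : ℝ} (hd : DobM X e) (d : Fin m → ℝ) (hd0 : ∑ j, d j = 0) :
    ∑ i, |∑ j, X i j / (∑ k, X k j) * d j| ≤ (1 - e) * ∑ j, |d j| := by
  set v : Fin n → ℝ := fun i => ∑ j, X i j / (∑ k, X k j) * d j with hv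
  have hP1 : ∀ j, ∑ i, X i j / (∑ k, X k j) = 1 := by
    intro j; rw [← Finset.sum_div, div_self (h.col j).ne']
  have hvs : ∑ i, v i = 0 := by
    simp only [hv]
    rw [Finset.sum_comm]
    simp only [← Finset.sum_mul, hP1, one_mul, hd0]
  set I : Finset (Fin n) := Finset.univ.filter (fun i => 0 ≤ v i) with hI
  set f : Fin m → ℝ := fun j => ∑ i ∈ I, X i j / (∑ k, X k j) with hf
  have hff : ∀ j j', f j - f j' ≤ 1 - e := by
    intro j j'
    have h1 := hd I j j'
    have h2 := Finset.sum_add_sum_compl I (fun i => X i j / (∑ k, X k j))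
    rw [hP1] at h2
    simp only [hf]
    linarith
  have hne : Nonempty (Fin m) := ⟨⟨0, hm⟩⟩
  obtain ⟨a, ha⟩ := Finite.exists_max f
  obtain ⟨b, hb⟩ := Finite.exists_min f
  have hab := hff a b
  have hsum : ∑ i, |v i| = 2 * ∑ i ∈ I, v i := by
    have h1 : ∀ i, |v i| = 2 * (if 0 ≤ v i then v i else 0) - v i := by
      intro i
      split_ifs with hc
      · rw [abs_of_nonneg hc]; ring
      · rw [abs_of_neg (not_le.mp hc)]; ring
    rw [Finset.sum_congr rfl (fun i _ => h1 i), Finset.sum_sub_distrib, hvs, ← Finset.mul_sum,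
      hI, Finset.sum_filter]
    ring
  have hsum2 : ∑ i ∈ I, v i = ∑ j, (f j - (f a + f b) / 2) * d j := by
    simp only [sub_mul, Finset.sum_sub_distrib]
    rw [← Finset.mul_sum, hd0, mul_zero, sub_zero]
    simp only [hv, hf, Finset.sum_mul]
    rw [Finset.sum_comm]
  change ∑ i, |v i| ≤ _
  rw [hsum, hsum2, Finset.mul_sum, Finset.mul_sum]
  apply Finset.sum_le_sum
  intro j _
  have h1 : |f j - (f a + f b) / 2| ≤ (1 - e) / 2 := by
    rw [abs_le]
    constructor <;> linarith [ha j, hb j]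
  have h2 := le_abs_self ((f j - (f a + f b) / 2) * d j)
  rw [abs_mul] at h2
  have h3 := mul_le_mul_of_nonneg_right h1 (abs_nonneg (d j))
  linarith

lemma colBal_err {n m : ℕ} {X : Matrix (Fin n) (Fin m) ℝ} (h : GoodM X) (hm : 0 < m)
    {e : ℝ} (hd : DobM X e) (p : Fin n → ℝ) (q : Fin m → ℝ) (hX : ∀ i, ∑ j, X i j = p i)
    (hbal : ∑ i, p i = ∑ j, q j) :
    lyap p q (colBal q X) ≤ (1 - e) * ∑ j, |(∑ i, X i j) - q j| := by
  have hd0 : ∑ j, (q j - ∑ i, X i j) = 0 := by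
    rw [Finset.sum_sub_distrib, Finset.sum_comm]
    simp only [hX, hbal, sub_self]
  have := dobrushin h hm hd (fun j => q j - ∑ i, X i j) hd0
  unfold lyap
  simp only [colBal_col h, sub_self, abs_zero, Finset.sum_const_zero, add_zero]
  have h1 : ∀ i, (∑ j, colBal q X i j) - p i =
      ∑ j, X i j / (∑ k, X k j) * (q j - ∑ i, X i j) := by
    intro i
    rw [← hX i, ← Finset.sum_sub_distrib]
    exact Finset.sum_congr rfl fun j _ => colBal_sub h q i j
  simp only [h1]
  simpa only [abs_sub_comm] using this

lemma epsP_dob {n m : ℕ} (hn : 2 ≤ n) (hm : 2 ≤ m) {X : Matrix (Fin n) (Fin m) ℝ}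
    (h : GoodM X) : epsP X ≤ 1 ∧ DobM X (epsP X) := by
  have hP0 : ∀ i j, 0 ≤ X i j / (∑ k, X k j) := fun i j => div_nonneg (h.1 i j) (h.col j).le
  have hP1 : ∀ j, ∑ i, X i j / (∑ k, X k j) = 1 := by
    intro j; rw [← Finset.sum_div, div_self (h.col j).ne']
  have hs : ∀ (S : Finset (Fin n)) j, 0 ≤ ∑ i ∈ S, X i j / (∑ k, X k j) :=
    fun S j => Finset.sum_nonneg fun i _ => hP0 i j
  have main : ∀ (I : Finset (Fin n)) (j j' : Fin m), I.Nonempty → I ≠ Finset.univ → j ≠ j' →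
      epsP X ≤ ∑ i ∈ Iᶜ, X i j / ∑ k, X k j + ∑ i ∈ I, X i j' / ∑ k, X k j' := by
    intro I j j' hI hI' hj
    have h1 : epsP X ≤
        sInf ((fun j => ∑ i ∈ Iᶜ, X i j / ∑ k, X k j) '' (({j} : Finset (Fin m)) : Set (Fin m))) +
        sInf ((fun j => ∑ i ∈ I, X i j / ∑ k, X k j) ''
          ((({j} : Finset (Fin m))ᶜ : Finset (Fin m)) : Set (Fin m))) := by
      apply csInf_le
      · refine ⟨0, ?_⟩
        rintro v ⟨I, J, -, -, -, -, rfl⟩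
        apply add_nonneg <;> apply Real.sInf_nonneg <;> rintro _ ⟨j, -, rfl⟩ <;> exact hs _ _
      · refine ⟨I, {j}, hI, hI', Finset.singleton_nonempty _, ?_, rfl⟩
        intro hc
        have : j' ∈ ({j} : Finset (Fin m)) := hc ▸ Finset.mem_univ _
        exact hj (Finset.mem_singleton.mp this).symm
    refine h1.trans (add_le_add ?_ ?_)
    · simp
    · apply csInf_le
      · refine ⟨0, ?_⟩
        rintro _ ⟨j, -, rfl⟩
        exact hs _ _
      · refine ⟨j', ?_, rfl⟩
        simp [hj.symm]
  have hle : epsP X ≤ 1 := by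
    let i0 : Fin n := ⟨0, by omega⟩
    let i1 : Fin n := ⟨1, by omega⟩
    let j0 : Fin m := ⟨0, by omega⟩
    let j1 : Fin m := ⟨1, by omega⟩
    have hij : j0 ≠ j1 := by simp [j0, j1]
    have hii : ({i0} : Finset (Fin n)) ≠ Finset.univ := by
      intro hc
      have : i1 ∈ ({i0} : Finset (Fin n)) := hc ▸ Finset.mem_univ _
      simp [i0, i1] at this
    have a1 := main {i0} j0 j1 (Finset.singleton_nonempty _) hii hij
    have a2 := main {i0} j1 j0 (Finset.singleton_nonempty _) hii hij.symm
    have a3 := Finset.sum_add_sum_compl {i0} (fun i => X i j0 / (∑ k, X k j0))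
    have a4 := Finset.sum_add_sum_compl {i0} (fun i => X i j1 / (∑ k, X k j1))
    rw [hP1] at a3 a4
    linarith
  refine ⟨hle, fun I j j' => ?_⟩
  rcases I.eq_empty_or_nonempty with rfl | hI
  · simpa [hP1] using hle
  by_cases hI' : I = Finset.univ
  · subst hI'
    simpa [hP1] using hle
  rcases eq_or_ne j j' with rfl | hj
  · have a3 := Finset.sum_add_sum_compl I (fun i => X i j / (∑ k, X k j))
    rw [hP1] at a3
    linarith
  · exact main I j j' hI hI' hj

lemma step_diff {n m : ℕ} {X : Matrix (Fin n) (Fin m) ℝ} (h : GoodM X)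
    {p : Fin n → ℝ} (hp : ∀ i, 0 < p i) (q : Fin m → ℝ) (i : Fin n) (j : Fin m) :
    |colBal q (rowBal p X) i j - X i j| ≤ 2 * lyap p q X := by
  have hZ := h.rowBal hp
  have h1 : |rowBal p X i j - X i j| ≤ lyap p q X := by
    rw [rowBal_sub h]
    refine le_trans ?_ (rowerr1 p q X i)
    apply mul_le_of_le_one_left (abs_nonneg _)
    rw [div_le_one (h.row i)]
    exact Finset.single_le_sum (f := fun j => X i j) (fun j _ => h.1 i j) (Finset.mem_univ j)
  have h2 : |colBal q (rowBal p X) i j - rowBal p X i j| ≤ lyap p q X := by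
    rw [colBal_sub hZ, abs_mul, abs_of_nonneg (div_nonneg (hZ.1 i j) (hZ.col j).le), abs_sub_comm]
    refine le_trans ?_ (rowBal_err h p q)
    refine le_trans ?_ (Finset.single_le_sum (f := fun j => |(∑ i, rowBal p X i j) - q j|)
      (fun _ _ => abs_nonneg _) (Finset.mem_univ j))
    apply mul_le_of_le_one_left (abs_nonneg _)
    rw [div_le_one (hZ.col j)]
    exact Finset.single_le_sum (f := fun i => rowBal p X i j) (fun i _ => hZ.1 i j)
      (Finset.mem_univ i)
  have := abs_sub_le (colBal q (rowBal p X) i j) (rowBal p X i j) (X i j)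
  linarith

lemma start_ineq {w ε : ℝ} (hw0 : 0 ≤ w) (hw1 : w < 1) (he : 0 < ε) (he1 : ε ≤ 1)
    (h3 : 2 * w * (1 + w * rF w ε) ≤ ε) : 0 < ε * (1 - w) - w := by
  rcases hw0.eq_or_lt with rfl | hw
  · simpa using he
  have hr : 0 < rF w ε := by
    unfold rF
    have h1 : 1 + ε * w - (1 + ε) * w ^ 2 = (1 - w) * (1 + (1 + ε) * w) := by ring
    rw [h1]
    have : 0 < 1 - w := by linarith
    apply div_pos
    · have : (1 - w) ^ 2 < 1 := by nlinarith
      nlinarith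
    · positivity
  have hx : 0 < w * rF w ε := mul_pos hw hr
  generalize w * rF w ε = x at *
  have h2 : w ≤ 1 / 2 := by nlinarith
  have h4 : 2 * w * (1 + x) * (1 - w) ≤ ε * (1 - w) :=
    mul_le_mul_of_nonneg_right h3 (by linarith)
  have h5 : w * (1 + x) ≤ w * (1 + x) * (2 * (1 - w)) :=
    le_mul_of_one_le_right (by positivity) (by linarith)
  nlinarith [mul_pos hw hx]

lemma iterBal_succ2 {n m : ℕ} (p : Fin n → ℝ) (q : Fin m → ℝ)
    (A : Matrix (Fin n) (Fin m) ℝ) (t : ℕ) :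
    iterBal p q A (2 * (t + 1)) = colBal q (rowBal p (iterBal p q A (2 * t))) := by
  have h1 : 2 * (t + 1) = 2 * t + 1 + 1 := by ring
  rw [h1, iterBal, if_neg (by omega), iterBal, if_pos (by omega)]

/-- Theorem 2: under the hypotheses of Theorem 1, the even iterates converge to a unique
element of the admissible set, which is nonnegative and preserves the zero pattern of A. -/
theorem balancing_converges_to_admissible_point
    {n m : ℕ} (hn : 2 ≤ n) (hm : 2 ≤ m)
    (A : Matrix (Fin n) (Fin m) ℝ) (p : Fin n → ℝ) (q : Fin m → ℝ)
    (hA : ∀ i j, 0 ≤ A i j)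
    (hrow : ∀ i, ∃ j, A i j ≠ 0)
    (hcol : ∀ j, ∃ i, A i j ≠ 0)
    (hp : ∀ i, 0 < p i) (hq : ∀ j, 0 < q j)
    (hbal : ∑ i, p i = ∑ j, q j)
    (heps : 0 < epsP A)
    (hw1 : lyap p q A / (⨅ i, p i) < 1)
    (hw2 : epsP A < (1 + lyap p q A / (⨅ i, p i)) / (1 - lyap p q A / (⨅ i, p i)))
    (hw3 : 2 * (lyap p q A / (⨅ i, p i)) *
        (1 + (lyap p q A / (⨅ i, p i)) * rF (lyap p q A / (⨅ i, p i)) (epsP A)) ≤ epsP A) :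
    ∃ X' : Matrix (Fin n) (Fin m) ℝ,
      Filter.Tendsto (fun t => iterBal p q A (2 * t)) Filter.atTop (nhds X') ∧
      (∀ i, ∑ j, X' i j = p i) ∧ (∀ j, ∑ i, X' i j = q j) ∧
      (∀ i j, 0 ≤ X' i j) ∧ (∀ i j, A i j = 0 → X' i j = 0) := by
  have hG0 : GoodM A := ⟨hA, fun i => (hrow i).imp fun j hj => lt_of_le_of_ne (hA i j) hj.symm,
    fun j => (hcol j).imp fun i hi => lt_of_le_of_ne (hA i j) hi.symm⟩
  obtain ⟨he1, hD0⟩ := epsP_dob hn hm hG0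
  have hne : Nonempty (Fin n) := ⟨⟨0, by omega⟩⟩
  have hμ : 0 < ⨅ i, p i := by
    obtain ⟨i, hi⟩ := exists_eq_ciInf_of_finite (f := p)
    rw [← hi]; exact hp i
  have hμp : ∀ i, (⨅ i, p i) ≤ p i := fun i => ciInf_le (Set.finite_range p).bddBelow i
  generalize (⨅ i, p i) = μ at *
  set w₀ := lyap p q A / μ with hw₀
  have hw0 : 0 ≤ w₀ := div_nonneg (lyap_nonneg' _ _ _) hμ.le
  have hstart := start_ineq hw0 hw1 heps he1 hw3
  set δ := epsP A * (1 - w₀) - w₀ with hδ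
  have hδ1 : δ ≤ 1 := by nlinarith
  have inv : ∀ t, GoodM (iterBal p q A (2 * t)) ∧
      (∀ i j, A i j = 0 → iterBal p q A (2 * t) i j = 0) ∧
      ∃ e w, DobM (iterBal p q A (2 * t)) e ∧ lyap p q (iterBal p q A (2 * t)) = w * μ ∧
        0 ≤ w ∧ w < 1 ∧ δ ≤ e * (1 - w) - w ∧ w ≤ w₀ * (1 - δ) ^ t := by
    intro t
    induction t with
    | zero =>
      refine ⟨hG0, fun i j h => h, epsP A, w₀, hD0, ?_, hw0, hw1, le_rfl, by simp⟩
      change lyap p q A = _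
      rw [hw₀]; field_simp
    | succ t ih =>
      obtain ⟨hG, hz, e, w, hD, hl, hw, hw', hδe, hwt⟩ := ih
      rw [iterBal_succ2]
      generalize iterBal p q A (2 * t) = Y at *
      have hZ := hG.rowBal hp
      have hDZ := rowBal_dob hG hp q hμ hμp hl hw' hD
      have hc := colBal_err hZ (by omega) hDZ p q (rowBal_row hG p) hbal
      have hr := rowBal_err hG p q
      have hDY := colBal_dob hZ hq hDZ
      have hGY := hZ.colBal hq
      have hV := lyap_nonneg' p q (colBal q (rowBal p Y))
      refine ⟨hGY, ?_, (1 - w) * e, lyap p q (colBal q (rowBal p Y)) / μ, hDY, ?_, ?_⟩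
      · intro i j h
        simp [colBal, rowBal, hz i j h]
      · field_simp
      have he' : δ + w ≤ (1 - w) * e := by linarith
      have hle1 : (1 - w) * e ≤ 1 := by
        have h1 := hDZ ∅ ⟨0, by omega⟩ ⟨0, by omega⟩
        rw [Finset.compl_empty, Finset.sum_empty, ← Finset.sum_div,
          div_self (hZ.col _).ne', add_zero] at h1
        exact h1
      generalize (1 - w) * e = e' at *
      have hw2 : lyap p q (colBal q (rowBal p Y)) / μ ≤ (1 - e') * w := by
        rw [div_le_iff₀ hμ, mul_assoc, ← hl]
        exact hc.trans (mul_le_mul_of_nonneg_left hr (by linarith))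
      have hw3 : 0 ≤ lyap p q (colBal q (rowBal p Y)) / μ := div_nonneg hV hμ.le
      generalize lyap p q (colBal q (rowBal p Y)) / μ = w' at *
      have he0 : 0 < e' := by linarith
      have hww : w' ≤ w := by nlinarith
      refine ⟨hw3, by linarith, ?_, ?_⟩
      · nlinarith [mul_nonneg he0.le (sub_nonneg.mpr hww)]
      · have h1 : (1 - e') * w ≤ (1 - δ) * w := mul_le_mul_of_nonneg_right (by linarith) hw
        have h2 : (1 - δ) * w ≤ (1 - δ) * (w₀ * (1 - δ) ^ t) :=
          mul_le_mul_of_nonneg_left hwt (by linarith)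
        rw [pow_succ]
        linarith
  have hlV : ∀ t, lyap p q (iterBal p q A (2 * t)) ≤ w₀ * μ * (1 - δ) ^ t := by
    intro t
    obtain ⟨-, -, e, w, -, hl, -, -, -, hwt⟩ := inv t
    rw [hl]
    have := mul_le_mul_of_nonneg_right hwt hμ.le
    linarith
  have hlim0 : Filter.Tendsto (fun t : ℕ => w₀ * μ * (1 - δ) ^ t) Filter.atTop (nhds 0) := by
    simpa using (tendsto_pow_atTop_nhds_zero_of_lt_one (by linarith : (0:ℝ) ≤ 1 - δ)
      (by linarith)).const_mul (w₀ * μ)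
  have hconv : ∀ i j, ∃ x, Filter.Tendsto (fun t => iterBal p q A (2 * t) i j)
      Filter.atTop (nhds x) := by
    intro i j
    apply cauchySeq_tendsto_of_complete
    apply cauchySeq_of_le_geometric (1 - δ) (2 * (w₀ * μ)) (by linarith)
    intro t
    rw [dist_comm, Real.dist_eq, iterBal_succ2]
    have := step_diff (inv t).1 hp q i j
    have := hlV t
    linarith
  choose X hX using hconv
  have hsqueeze : ∀ (f : ℕ → ℝ) (a b : ℝ), Filter.Tendsto f Filter.atTop (nhds a) →
      (∀ t, |f t - b| ≤ lyap p q (iterBal p q A (2 * t))) → a = b := by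
    intro f a b hf hb
    refine tendsto_nhds_unique hf ?_
    rw [tendsto_iff_dist_tendsto_zero]
    exact squeeze_zero (fun _ => dist_nonneg) (fun t => (hb t).trans (hlV t)) hlim0
  refine ⟨X, ?_, ?_, ?_, ?_, ?_⟩
  · exact tendsto_pi_nhds.mpr fun i => tendsto_pi_nhds.mpr fun j => hX i j
  · intro i
    exact hsqueeze _ _ _ (tendsto_finsetSum _ fun j _ => hX i j) fun t => rowerr1 p q _ i
  · intro j
    exact hsqueeze _ _ _ (tendsto_finsetSum _ fun i _ => hX i j) fun t => colerr1 p q _ j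
  · intro i j
    exact ge_of_tendsto' (hX i j) fun t => (inv t).1.1 i j
  · intro i j h
    refine tendsto_nhds_unique (hX i j) ?_
    simp only [(inv _).2.1 i j h]
    exact tendsto_const_nhds
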